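/- arXiv:gr-qc/0607070 — 2 statements merged into one kernel-verified Lean document; each statement's English description precedes it below -/
import Mathlib

section
/- For every C² function v on Ω_r, the reduced Kerr wave operator satisfies the identity □ₘ v = −(1/(2Σ))(Δ D² + L²)v, where D² = D₁D₀⁺ + D₁⁺D₀ and L² = L₁L₀⁺ + L₁⁺L₀. -/
noncomputable section

/-- Functions of `(t, r, θ)`. -/
abbrev F3 := ℝ × ℝ × ℝ → ℂ

/-- Partial derivative with respect to `t`. -/
noncomputable def dT (u : F3) (p : ℝ × ℝ × ℝ) : ℂ :=
  deriv (fun s => u (s, p.2.1, p.2.2)) p.1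

/-- Partial derivative with respect to `r`. -/
noncomputable def dR (u : F3) (p : ℝ × ℝ × ℝ) : ℂ :=
  deriv (fun s => u (p.1, s, p.2.2)) p.2.1

/-- Partial derivative with respect to `θ`. -/
noncomputable def dTh (u : F3) (p : ℝ × ℝ × ℝ) : ℂ :=
  deriv (fun s => u (p.1, p.2.1, s)) p.2.2

/-- `Δ = r² - 2Mr + a²`. -/
def Del (M a r : ℝ) : ℝ := r ^ 2 - 2 * M * r + a ^ 2

/-- `Σ = r² + a² cos² θ`. -/
def Sig (a r θ : ℝ) : ℝ := r ^ 2 + a ^ 2 * Real.cos θ ^ 2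

/-- `r₊ = M + √(M² - a²)`. -/
noncomputable def rplus (M a : ℝ) : ℝ := M + Real.sqrt (M ^ 2 - a ^ 2)

/-- `Ω_r = ℝ × (r₊, ∞) × (0, π)`. -/
def OmegaR (M a : ℝ) : Set (ℝ × ℝ × ℝ) :=
  {p | rplus M a < p.2.1 ∧ 0 < p.2.2 ∧ p.2.2 < Real.pi}

/-- The reduced Kerr wave operator `□ₘ`. -/
noncomputable def boxm (M a : ℝ) (m : ℤ) (u : F3) : F3 := fun p =>
  (Complex.ofReal (Sig a p.2.1 p.2.2))⁻¹ *
    (Complex.ofReal ((p.2.1 ^ 2 + a ^ 2) ^ 2 / Del M a p.2.1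
        - a ^ 2 * Real.sin p.2.2 ^ 2) * dT (dT u) p
      + 4 * Complex.I * (m : ℂ) * Complex.ofReal M * Complex.ofReal a
          * Complex.ofReal p.2.1 / Complex.ofReal (Del M a p.2.1) * dT u p
      - dR (fun q => Complex.ofReal (Del M a q.2.1) * dR u q) p
      - (Complex.ofReal (Real.sin p.2.2))⁻¹
          * dTh (fun q => Complex.ofReal (Real.sin q.2.2) * dTh u q) p
      - (m : ℂ) ^ 2 * Complex.ofReal (a ^ 2 / Del M a p.2.1
          - (Real.sin p.2.2 ^ 2)⁻¹) * u p)

/-- The Killing-tensor operator `□̄ₘ`. -/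
noncomputable def barboxm (M a : ℝ) (m : ℤ) (u : F3) : F3 := fun p =>
  (Complex.ofReal (Sig a p.2.1 p.2.2))⁻¹ *
    (Complex.ofReal (a ^ 2 * (p.2.1 ^ 2 * Real.sin p.2.2 ^ 2
        + Real.cos p.2.2 ^ 2 * (p.2.1 ^ 2 + a ^ 2) ^ 2 / Del M a p.2.1)) * dT (dT u) p
      + 2 * Complex.I * (m : ℂ) * Complex.ofReal a
          * Complex.ofReal (p.2.1 ^ 2 + a ^ 2 * Real.cos p.2.2 ^ 2
              * (p.2.1 ^ 2 + a ^ 2) / Del M a p.2.1) * dT u p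
      - Complex.ofReal (a ^ 2 * Real.cos p.2.2 ^ 2)
          * dR (fun q => Complex.ofReal (Del M a q.2.1) * dR u q) p
      + Complex.ofReal (p.2.1 ^ 2 / Real.sin p.2.2)
          * dTh (fun q => Complex.ofReal (Real.sin q.2.2) * dTh u q) p
      - (m : ℂ) ^ 2 * Complex.ofReal (p.2.1 ^ 2 / Real.sin p.2.2 ^ 2
          + a ^ 4 * Real.cos p.2.2 ^ 2 / Del M a p.2.1) * u p)

/-- The ladder operator `Dₙ`. -/
noncomputable def Dlad (M a : ℝ) (m n : ℤ) (u : F3) : F3 := fun p =>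
  dR u p + (Complex.ofReal (Del M a p.2.1))⁻¹ *
      (Complex.ofReal (p.2.1 ^ 2 + a ^ 2) * dT u p
        + Complex.I * (m : ℂ) * Complex.ofReal a * u p)
    + Complex.ofReal (2 * (n : ℝ) * (p.2.1 - M) / Del M a p.2.1) * u p

/-- The ladder operator `Dₙ⁺`. -/
noncomputable def DladP (M a : ℝ) (m n : ℤ) (u : F3) : F3 := fun p =>
  dR u p - (Complex.ofReal (Del M a p.2.1))⁻¹ *
      (Complex.ofReal (p.2.1 ^ 2 + a ^ 2) * dT u p
        + Complex.I * (m : ℂ) * Complex.ofReal a * u p)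
    + Complex.ofReal (2 * (n : ℝ) * (p.2.1 - M) / Del M a p.2.1) * u p

/-- The ladder operator `Lₙ`. -/
noncomputable def Llad (a : ℝ) (m n : ℤ) (u : F3) : F3 := fun p =>
  dTh u p + (-Complex.I * Complex.ofReal a * Complex.ofReal (Real.sin p.2.2) * dT u p
      + (m : ℂ) * (Complex.ofReal (Real.sin p.2.2))⁻¹ * u p)
    + (n : ℂ) * Complex.ofReal (Real.cos p.2.2 / Real.sin p.2.2) * u p

/-- The ladder operator `Lₙ⁺`. -/
noncomputable def LladP (a : ℝ) (m n : ℤ) (u : F3) : F3 := fun p =>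
  dTh u p - (-Complex.I * Complex.ofReal a * Complex.ofReal (Real.sin p.2.2) * dT u p
      + (m : ℂ) * (Complex.ofReal (Real.sin p.2.2))⁻¹ * u p)
    + (n : ℂ) * Complex.ofReal (Real.cos p.2.2 / Real.sin p.2.2) * u p

/-- `D² = D₁D₀⁺ + D₁⁺D₀`. -/
noncomputable def D2 (M a : ℝ) (m : ℤ) (u : F3) : F3 := fun p =>
  Dlad M a m 1 (DladP M a m 0 u) p + DladP M a m 1 (Dlad M a m 0 u) p

/-- `L² = L₁L₀⁺ + L₁⁺L₀`. -/
noncomputable def L2 (a : ℝ) (m : ℤ) (u : F3) : F3 := fun p =>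
  Llad a m 1 (LladP a m 0 u) p + LladP a m 1 (Llad a m 0 u) p

/-- The operator `P` appearing in the symmetry operator `S`. -/
noncomputable def Pop (M a : ℝ) (m : ℤ) (u : F3) : F3 := fun p =>
  -2 * Complex.I * (m : ℂ) * Complex.ofReal a
      * Complex.ofReal ((p.2.1 ^ 2 + a ^ 2) * Sig a p.2.1 p.2.2) * dT u p
    - Complex.ofReal (a ^ 2 * Real.sin p.2.2 ^ 2 * Del M a p.2.1)
        * dR (fun q => Complex.ofReal (Del M a q.2.1) * dR u q) p
    - Complex.ofReal ((p.2.1 ^ 2 + a ^ 2) ^ 2 / Real.sin p.2.2)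
        * dTh (fun q => Complex.ofReal (Real.sin q.2.2) * dTh u q) p
    + (m : ℂ) ^ 2 * Complex.ofReal (Sig a p.2.1 p.2.2 / Real.sin p.2.2 ^ 2
        * (Sig a p.2.1 p.2.2 + 2 * a ^ 2 * Real.sin p.2.2 ^ 2)) * u p

/-- The new first-order-in-time symmetry operator `S`. -/
noncomputable def Sop (M a : ℝ) (m : ℤ) (u : F3) : F3 := fun p =>
  (Complex.ofReal ((p.2.1 ^ 2 + a ^ 2) * Sig a p.2.1 p.2.2
      + 2 * M * a ^ 2 * p.2.1 * Real.sin p.2.2 ^ 2))⁻¹ * Pop M a m u p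

end

theorem isOpen_OmegaR (M a : ℝ) : IsOpen (OmegaR M a) :=
  (isOpen_lt continuous_const (continuous_fst.comp continuous_snd)).inter
    ((isOpen_lt continuous_const (continuous_snd.comp continuous_snd)).inter
      (isOpen_lt (continuous_snd.comp continuous_snd) continuous_const))

theorem Del_pos {M a r : ℝ} (ha : 0 ≤ a) (haM : a ≤ M) (hr : rplus M a < r) :
    0 < Del M a r := by
  have h0 : 0 ≤ M ^ 2 - a ^ 2 := by nlinarith
  have hs := Real.sq_sqrt h0
  have hn := Real.sqrt_nonneg (M ^ 2 - a ^ 2)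
  unfold rplus at hr
  unfold Del
  nlinarith

theorem DifferentiableAt.complex_ofReal {E : Type*} [NormedAddCommGroup E] [NormedSpace ℝ E]
    {f : E → ℝ} {x : E} (h : DifferentiableAt ℝ f x) :
    DifferentiableAt ℝ (fun y => (f y : ℂ)) x :=
  Complex.ofRealCLM.differentiableAt.comp x h

section PartialDerivatives

variable {u w : F3} {p : ℝ × ℝ × ℝ}

theorem hasDerivAt_dT (h : DifferentiableAt ℝ u p) :
    HasDerivAt (fun s => u (s, p.2.1, p.2.2)) (dT u p) p.1 :=
  (DifferentiableAt.comp p.1 (f := fun s : ℝ => (s, p.2.1, p.2.2)) h (by fun_prop)).hasDerivAt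

theorem hasDerivAt_dR (h : DifferentiableAt ℝ u p) :
    HasDerivAt (fun s => u (p.1, s, p.2.2)) (dR u p) p.2.1 :=
  (DifferentiableAt.comp p.2.1 (f := fun s : ℝ => (p.1, s, p.2.2)) h (by fun_prop)).hasDerivAt

theorem hasDerivAt_dTh (h : DifferentiableAt ℝ u p) :
    HasDerivAt (fun s => u (p.1, p.2.1, s)) (dTh u p) p.2.2 :=
  (DifferentiableAt.comp p.2.2 (f := fun s : ℝ => (p.1, p.2.1, s)) h (by fun_prop)).hasDerivAt

theorem dT_eq_fderiv (h : DifferentiableAt ℝ u p) : dT u p = fderiv ℝ u p (1, 0, 0) :=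
  (h.hasFDerivAt.comp_hasDerivAt p.1 (f := fun s : ℝ => (s, p.2.1, p.2.2))
    ((hasDerivAt_id p.1).prodMk (hasDerivAt_const p.1 p.2))).deriv

theorem dR_eq_fderiv (h : DifferentiableAt ℝ u p) : dR u p = fderiv ℝ u p (0, 1, 0) :=
  (h.hasFDerivAt.comp_hasDerivAt p.2.1 (f := fun s : ℝ => (p.1, s, p.2.2))
    ((hasDerivAt_const p.2.1 p.1).prodMk
      ((hasDerivAt_id p.2.1).prodMk (hasDerivAt_const p.2.1 p.2.2)))).deriv

theorem dTh_eq_fderiv (h : DifferentiableAt ℝ u p) : dTh u p = fderiv ℝ u p (0, 0, 1) :=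
  (h.hasFDerivAt.comp_hasDerivAt p.2.2 (f := fun s : ℝ => (p.1, p.2.1, s))
    ((hasDerivAt_const p.2.2 p.1).prodMk
      ((hasDerivAt_const p.2.2 p.2.1).prodMk (hasDerivAt_id p.2.2)))).deriv

theorem dT_add (hu : DifferentiableAt ℝ u p) (hw : DifferentiableAt ℝ w p) :
    dT (fun q => u q + w q) p = dT u p + dT w p :=
  ((hasDerivAt_dT hu).add (hasDerivAt_dT hw)).deriv

theorem dT_sub (hu : DifferentiableAt ℝ u p) (hw : DifferentiableAt ℝ w p) :
    dT (fun q => u q - w q) p = dT u p - dT w p :=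
  ((hasDerivAt_dT hu).sub (hasDerivAt_dT hw)).deriv

theorem dR_add (hu : DifferentiableAt ℝ u p) (hw : DifferentiableAt ℝ w p) :
    dR (fun q => u q + w q) p = dR u p + dR w p :=
  ((hasDerivAt_dR hu).add (hasDerivAt_dR hw)).deriv

theorem dR_sub (hu : DifferentiableAt ℝ u p) (hw : DifferentiableAt ℝ w p) :
    dR (fun q => u q - w q) p = dR u p - dR w p :=
  ((hasDerivAt_dR hu).sub (hasDerivAt_dR hw)).deriv

theorem dTh_add (hu : DifferentiableAt ℝ u p) (hw : DifferentiableAt ℝ w p) :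
    dTh (fun q => u q + w q) p = dTh u p + dTh w p :=
  ((hasDerivAt_dTh hu).add (hasDerivAt_dTh hw)).deriv

theorem dTh_sub (hu : DifferentiableAt ℝ u p) (hw : DifferentiableAt ℝ w p) :
    dTh (fun q => u q - w q) p = dTh u p - dTh w p :=
  ((hasDerivAt_dTh hu).sub (hasDerivAt_dTh hw)).deriv

theorem ContDiffAt.differentiableAt_fderiv_apply (h : ContDiffAt ℝ 2 u p) (e : ℝ × ℝ × ℝ) :
    DifferentiableAt ℝ (fun q => fderiv ℝ u q e) p :=
  ((h.fderiv_right (m := 1) (by norm_num)).differentiableAt (by norm_num)).clm_apply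
    (differentiableAt_const e)

theorem ContDiffAt.eventually_differentiableAt_real (h : ContDiffAt ℝ 2 u p) :
    ∀ᶠ q in nhds p, DifferentiableAt ℝ u q :=
  (h.eventually (by simp)).mono fun _ hq => hq.differentiableAt (by norm_num)

theorem ContDiffAt.differentiableAt_dT (h : ContDiffAt ℝ 2 u p) :
    DifferentiableAt ℝ (dT u) p :=
  (h.differentiableAt_fderiv_apply (1, 0, 0)).congr_of_eventuallyEq
    (h.eventually_differentiableAt_real.mono fun _ hq => dT_eq_fderiv hq)

theorem ContDiffAt.differentiableAt_dR (h : ContDiffAt ℝ 2 u p) :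
    DifferentiableAt ℝ (dR u) p :=
  (h.differentiableAt_fderiv_apply (0, 1, 0)).congr_of_eventuallyEq
    (h.eventually_differentiableAt_real.mono fun _ hq => dR_eq_fderiv hq)

theorem ContDiffAt.differentiableAt_dTh (h : ContDiffAt ℝ 2 u p) :
    DifferentiableAt ℝ (dTh u) p :=
  (h.differentiableAt_fderiv_apply (0, 0, 1)).congr_of_eventuallyEq
    (h.eventually_differentiableAt_real.mono fun _ hq => dTh_eq_fderiv hq)

theorem dR_Del_mul_dR (M a : ℝ) (h : DifferentiableAt ℝ (dR u) p) :
    dR (fun q => Complex.ofReal (Del M a q.2.1) * dR u q) p =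
      2 * (p.2.1 - M) * dR u p + Del M a p.2.1 * dR (dR u) p := by
  have hΔ : HasDerivAt (fun r => Del M a r) (2 * (p.2.1 - M)) p.2.1 := by
    refine ((((hasDerivAt_id p.2.1).pow 2).sub
      ((hasDerivAt_id p.2.1).const_mul (2 * M))).add_const (a ^ 2)).congr_deriv ?_
    norm_num
    ring
  refine (hΔ.ofReal_comp.mul (hasDerivAt_dR h)).deriv.trans ?_
  push_cast
  rfl

theorem dTh_sin_mul_dTh (h : DifferentiableAt ℝ (dTh u) p) :
    dTh (fun q => Complex.ofReal (Real.sin q.2.2) * dTh u q) p =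
      Real.cos p.2.2 * dTh u p + Real.sin p.2.2 * dTh (dTh u) p :=
  ((Real.hasDerivAt_sin p.2.2).ofReal_comp.mul (hasDerivAt_dTh h)).deriv

/-- `D²` in expanded form, the mixed `r`-derivatives having cancelled. -/
theorem Del_mul_D2 {M a : ℝ} {m : ℤ} (hΔ : Del M a p.2.1 ≠ 0) (h : ContDiffAt ℝ 2 u p) :
    Complex.ofReal (Del M a p.2.1) * D2 M a m u p =
      2 * (dR (fun q => Complex.ofReal (Del M a q.2.1) * dR u q) p
        - (Complex.ofReal (Del M a p.2.1))⁻¹ *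
          (Complex.ofReal (p.2.1 ^ 2 + a ^ 2) ^ 2 * dT (dT u) p
            + 2 * Complex.I * m * a * Complex.ofReal (p.2.1 ^ 2 + a ^ 2) * dT u p
            - m ^ 2 * a ^ 2 * u p)) := by
  set W : F3 := fun q => (Complex.ofReal (Del M a q.2.1))⁻¹ *
      (Complex.ofReal (q.2.1 ^ 2 + a ^ 2) * dT u q + Complex.I * (m : ℂ) * Complex.ofReal a * u q)
    with hW
  have hu := h.differentiableAt (by norm_num)
  have hT := h.differentiableAt_dT
  have hR := h.differentiableAt_dR
  have hcoe : DifferentiableAt ℝ (fun q : ℝ × ℝ × ℝ => Complex.ofReal (Del M a q.2.1)) p :=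
    DifferentiableAt.complex_ofReal (f := fun q : ℝ × ℝ × ℝ => Del M a q.2.1)
      (by unfold Del; fun_prop)
  have hcoe' : DifferentiableAt ℝ (fun q : ℝ × ℝ × ℝ => Complex.ofReal (q.2.1 ^ 2 + a ^ 2)) p :=
    DifferentiableAt.complex_ofReal (f := fun q : ℝ × ℝ × ℝ => q.2.1 ^ 2 + a ^ 2) (by fun_prop)
  have hΔ' : Complex.ofReal (Del M a p.2.1) ≠ 0 := Complex.ofReal_ne_zero.mpr hΔ
  have hWd : DifferentiableAt ℝ W p :=
    (hcoe.inv hΔ').mul ((hcoe'.mul hT).add (hu.const_mul _))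
  have hTW : dT W p = (Complex.ofReal (Del M a p.2.1))⁻¹ *
      (Complex.ofReal (p.2.1 ^ 2 + a ^ 2) * dT (dT u) p
        + Complex.I * (m : ℂ) * Complex.ofReal a * dT u p) :=
    ((((hasDerivAt_dT hT).const_mul (Complex.ofReal (p.2.1 ^ 2 + a ^ 2))).add
      ((hasDerivAt_dT hu).const_mul (Complex.I * (m : ℂ) * Complex.ofReal a))).const_mul
        (Complex.ofReal (Del M a p.2.1))⁻¹).deriv
  have hplus : Dlad M a m 0 u = fun q => dR u q + W q := by
    funext q; simp [Dlad, hW]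
  have hminus : DladP M a m 0 u = fun q => dR u q - W q := by
    funext q; simp [DladP, hW]
  rw [D2, hplus, hminus, dR_Del_mul_dR M a hR]
  simp only [Dlad, DladP]
  rw [dR_add hR hWd, dR_sub hR hWd, dT_add hR hWd, dT_sub hR hWd, hTW, hW]
  push_cast
  field_simp
  linear_combination (2 * (m : ℂ) ^ 2 * a ^ 2 * u p) * (-Complex.I_sq)

/-- `L²` in expanded form, the mixed `θ`-derivatives having cancelled. -/
theorem L2_eq {a : ℝ} {m : ℤ} (hs : Real.sin p.2.2 ≠ 0) (h : ContDiffAt ℝ 2 u p) :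
    L2 a m u p =
      2 * ((Complex.ofReal (Real.sin p.2.2))⁻¹ *
          dTh (fun q => Complex.ofReal (Real.sin q.2.2) * dTh u q) p
        + (a ^ 2 * Complex.ofReal (Real.sin p.2.2) ^ 2 * dT (dT u) p
          + 2 * Complex.I * m * a * dT u p
          - m ^ 2 * (Complex.ofReal (Real.sin p.2.2) ^ 2)⁻¹ * u p)) := by
  set V : F3 := fun q =>
      -Complex.I * Complex.ofReal a * Complex.ofReal (Real.sin q.2.2) * dT u q
        + (m : ℂ) * (Complex.ofReal (Real.sin q.2.2))⁻¹ * u q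
    with hV
  have hu := h.differentiableAt (by norm_num)
  have hT := h.differentiableAt_dT
  have hH := h.differentiableAt_dTh
  have hcoe : DifferentiableAt ℝ (fun q : ℝ × ℝ × ℝ => Complex.ofReal (Real.sin q.2.2)) p :=
    DifferentiableAt.complex_ofReal (f := fun q : ℝ × ℝ × ℝ => Real.sin q.2.2) (by fun_prop)
  have hs' : Complex.ofReal (Real.sin p.2.2) ≠ 0 := Complex.ofReal_ne_zero.mpr hs
  have hVd : DifferentiableAt ℝ V p :=
    ((hcoe.const_mul _).mul hT).add (((hcoe.inv hs').const_mul _).mul hu)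
  have hTV : dT V p = -Complex.I * Complex.ofReal a * Complex.ofReal (Real.sin p.2.2) * dT (dT u) p
        + (m : ℂ) * (Complex.ofReal (Real.sin p.2.2))⁻¹ * dT u p :=
    (((hasDerivAt_dT hT).const_mul
      (-Complex.I * Complex.ofReal a * Complex.ofReal (Real.sin p.2.2))).add
        ((hasDerivAt_dT hu).const_mul ((m : ℂ) * (Complex.ofReal (Real.sin p.2.2))⁻¹))).deriv
  have hplus : Llad a m 0 u = fun q => dTh u q + V q := by
    funext q; simp [Llad, hV]
  have hminus : LladP a m 0 u = fun q => dTh u q - V q := by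
    funext q; simp [LladP, hV]
  rw [L2, hplus, hminus, dTh_sin_mul_dTh hH]
  simp only [Llad, LladP]
  rw [dTh_add hH hVd, dTh_sub hH hVd, dT_add hH hVd, dT_sub hH hVd, hTV, hV]
  rw [Complex.ofReal_div, Int.cast_one]
  beta_reduce
  generalize Complex.ofReal (Real.sin p.2.2) = s at *
  field_simp
  linear_combination (-2 * (a : ℂ) ^ 2 * s ^ 4 * dT (dT u) p) * Complex.I_sq

end PartialDerivatives

/-- `□ₘ v = -(1/(2Σ))(Δ D² + L²)v` for `C²` functions on `Ω_r`. -/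
theorem boxm_ladder_rep (M a : ℝ) (m : ℤ) (hM : 0 < M) (ha : 0 ≤ a) (haM : a ≤ M)
    (v : F3) (hv : ContDiffOn ℝ 2 v (OmegaR M a)) :
    ∀ p ∈ OmegaR M a,
      boxm M a m v p =
        -(Complex.ofReal (2 * Sig a p.2.1 p.2.2))⁻¹ *
          (Complex.ofReal (Del M a p.2.1) * D2 M a m v p + L2 a m v p) := by
  rintro p hp
  have h : ContDiffAt ℝ 2 v p := hv.contDiffAt ((isOpen_OmegaR M a).mem_nhds hp)
  have hΔ : Del M a p.2.1 ≠ 0 := (Del_pos ha haM hp.1).ne'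
  have hs : Real.sin p.2.2 ≠ 0 := (Real.sin_pos_of_pos_of_lt_pi hp.2.1 hp.2.2).ne'
  rw [Del_mul_D2 hΔ h, L2_eq hs h, boxm]
  have hΔ' : Complex.ofReal (Del M a p.2.1) ≠ 0 := Complex.ofReal_ne_zero.mpr hΔ
  have hdef : Complex.ofReal (Del M a p.2.1) = p.2.1 ^ 2 - 2 * M * p.2.1 + a ^ 2 := by
    simp [Del]
  have hcross : 4 * Complex.I * m * M * a * p.2.1 / Complex.ofReal (Del M a p.2.1) =
      2 * Complex.I * m * a *
        ((p.2.1 ^ 2 + a ^ 2) * (Complex.ofReal (Del M a p.2.1))⁻¹ - 1) := by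
    field_simp
    rw [hdef]
    ring
  rw [hcross]
  simp only [Complex.ofReal_sub, Complex.ofReal_mul, Complex.ofReal_div, Complex.ofReal_add,
    Complex.ofReal_pow, Complex.ofReal_inv, Complex.ofReal_ofNat, mul_inv]
  ring
end

section
/- For (u,v) ∈ C⁴₀(Ω_rs, ℂ) × C²₀(Ω_rs, ℂ), the operator Ŝ commutes with the generator G of time evolution: Ŝ G(u,v) = G Ŝ(u,v). -/
noncomputable section

/-- Functions of `(r, θ)`. -/
abbrev F2 := ℝ × ℝ → ℂ

/-- Partial derivative with respect to `r`. -/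
noncomputable def dR2 (u : F2) (p : ℝ × ℝ) : ℂ := deriv (fun s => u (s, p.2)) p.1

/-- Partial derivative with respect to `θ`. -/
noncomputable def dTh2 (u : F2) (p : ℝ × ℝ) : ℂ := deriv (fun s => u (p.1, s)) p.2

/-- `Δ = r² - 2Mr + a²`. -/
def Del2 (M a r : ℝ) : ℝ := r ^ 2 - 2 * M * r + a ^ 2

/-- `Σ = r² + a² cos²θ`. -/
def Sig2 (a : ℝ) (p : ℝ × ℝ) : ℝ := p.1 ^ 2 + a ^ 2 * Real.cos p.2 ^ 2

/-- `ΔΣ̄ = (r²+a²)Σ + 2Ma²r sin²θ`. -/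
def DSb (M a : ℝ) (p : ℝ × ℝ) : ℝ :=
  (p.1 ^ 2 + a ^ 2) * Sig2 a p + 2 * M * a ^ 2 * p.1 * Real.sin p.2 ^ 2

/-- `Ω_rs = (r₊, ∞) × (0, π)`. -/
noncomputable def OmegaRS (M a : ℝ) : Set (ℝ × ℝ) :=
  Set.Ioi (M + Real.sqrt (M ^ 2 - a ^ 2)) ×ˢ Set.Ioo 0 Real.pi

/-- The spatial operator `A + C`. -/
noncomputable def ACop (M a : ℝ) (m : ℤ) (u : F2) : F2 := fun p =>
  (Complex.ofReal (DSb M a p))⁻¹ *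
    (-Complex.ofReal (Del2 M a p.1) * dR2 (fun q => Complex.ofReal (Del2 M a q.1) * dR2 u q) p
      - Complex.ofReal (Del2 M a p.1 / Real.sin p.2)
          * dTh2 (fun q => Complex.ofReal (Real.sin q.2) * dTh2 u q) p
      + (m : ℂ) ^ 2 * Complex.ofReal ((Del2 M a p.1 - a ^ 2 * Real.sin p.2 ^ 2)
          / Real.sin p.2 ^ 2) * u p)

/-- The multiplication operator `B`. -/
noncomputable def Bop (M a : ℝ) (m : ℤ) (v : F2) : F2 := fun p =>
  Complex.ofReal (4 * (m : ℝ) * M * a * p.1 / DSb M a p) * v p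

/-- The spatial part `P_s` of the symmetry operator. -/
noncomputable def Ps (M a : ℝ) (m : ℤ) (u : F2) : F2 := fun p =>
  -Complex.ofReal (a ^ 2 * Real.sin p.2 ^ 2 * Del2 M a p.1)
      * dR2 (fun q => Complex.ofReal (Del2 M a q.1) * dR2 u q) p
    - Complex.ofReal ((p.1 ^ 2 + a ^ 2) ^ 2 / Real.sin p.2)
        * dTh2 (fun q => Complex.ofReal (Real.sin q.2) * dTh2 u q) p
    + (m : ℂ) ^ 2 * Complex.ofReal (Sig2 a p / Real.sin p.2 ^ 2
        * (Sig2 a p + 2 * a ^ 2 * Real.sin p.2 ^ 2)) * u p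

/-- The generator of time evolution `G(u,v) = (-v, (A+C)u + iBv)`. -/
noncomputable def Gop (M a : ℝ) (m : ℤ) (w : F2 × F2) : F2 × F2 :=
  (fun p => -w.2 p, fun p => ACop M a m w.1 p + Complex.I * Bop M a m w.2 p)

/-- The induced symmetry operator `Ŝ`. -/
noncomputable def Shat (M a : ℝ) (m : ℤ) (w : F2 × F2) : F2 × F2 :=
  (fun p => (Complex.ofReal (DSb M a p))⁻¹ *
      (Ps M a m w.1 p - 2 * Complex.I * (m : ℂ) * Complex.ofReal a
        * Complex.ofReal ((p.1 ^ 2 + a ^ 2) * Sig2 a p) * w.2 p),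
   fun p => (Complex.ofReal (DSb M a p))⁻¹ *
      (2 * Complex.I * (m : ℂ) * Complex.ofReal a
          * Complex.ofReal ((p.1 ^ 2 + a ^ 2) * Sig2 a p) * ACop M a m w.1 p
        + Ps M a m w.2 p
        - 2 * (m : ℂ) * Complex.ofReal a
            * Complex.ofReal ((p.1 ^ 2 + a ^ 2) * Sig2 a p) * Bop M a m w.2 p))

end

open Set Filter Topology

lemma isOpen_OmegaRS (M a : ℝ) : IsOpen (OmegaRS M a) := isOpen_Ioi.prod isOpen_Ioo

lemma sin_pos_of_mem_OmegaRS {M a : ℝ} {p : ℝ × ℝ} (hp : p ∈ OmegaRS M a) :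
    0 < Real.sin p.2 := Real.sin_pos_of_mem_Ioo hp.2

lemma DSb_pos_of_mem_OmegaRS {M a : ℝ} (hM : 0 < M) {p : ℝ × ℝ} (hp : p ∈ OmegaRS M a) :
    0 < DSb M a p := by
  have hr : 0 < p.1 := by
    have h : M + Real.sqrt (M ^ 2 - a ^ 2) < p.1 := hp.1
    linarith [Real.sqrt_nonneg (M ^ 2 - a ^ 2)]
  unfold DSb Sig2
  positivity

/-- `ΔΣ̄ = (r²+a²)² - a² sin²θ Δ`. -/
lemma DSb_eq (M a : ℝ) (p : ℝ × ℝ) :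
    DSb M a p = (p.1 ^ 2 + a ^ 2) ^ 2 - a ^ 2 * Real.sin p.2 ^ 2 * Del2 M a p.1 := by
  unfold DSb Sig2 Del2
  rw [Real.cos_sq']
  ring

section PartialDerivatives

variable {U : Set (ℝ × ℝ)} {f g : F2} {p : ℝ × ℝ}

lemma dR2_congr (hU : IsOpen U) (h : EqOn f g U) (hp : p ∈ U) : dR2 f p = dR2 g p := by
  refine EventuallyEq.deriv_eq ?_
  have hc : ContinuousAt (fun s : ℝ => (s, p.2)) p.1 := by fun_prop
  filter_upwards [hc (hU.mem_nhds hp)] with s hs using h hs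

lemma dTh2_congr (hU : IsOpen U) (h : EqOn f g U) (hp : p ∈ U) : dTh2 f p = dTh2 g p := by
  refine EventuallyEq.deriv_eq ?_
  have hc : ContinuousAt (fun s : ℝ => (p.1, s)) p.2 := by fun_prop
  filter_upwards [hc (hU.mem_nhds hp)] with s hs using h hs

lemma dR2_mul_left (c : ℝ → ℂ) (f : F2) (p : ℝ × ℝ) :
    dR2 (fun q => c q.2 * f q) p = c p.2 * dR2 f p :=
  deriv_const_mul_field (c p.2)

lemma dTh2_mul_left (c : ℝ → ℂ) (f : F2) (p : ℝ × ℝ) :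
    dTh2 (fun q => c q.1 * f q) p = c p.1 * dTh2 f p :=
  deriv_const_mul_field (c p.1)

lemma hasDerivAt_fst_slice (hf : DifferentiableAt ℝ f p) :
    HasDerivAt (fun s => f (s, p.2)) (fderiv ℝ f p (1, 0)) p.1 :=
  HasFDerivAt.comp_hasDerivAt (f := fun s : ℝ => (s, p.2)) p.1 hf.hasFDerivAt
    ((hasDerivAt_id p.1).prodMk (hasDerivAt_const p.1 p.2))

lemma hasDerivAt_snd_slice (hf : DifferentiableAt ℝ f p) :
    HasDerivAt (fun s => f (p.1, s)) (fderiv ℝ f p (0, 1)) p.2 :=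
  HasFDerivAt.comp_hasDerivAt (f := fun s : ℝ => (p.1, s)) p.2 hf.hasFDerivAt
    ((hasDerivAt_const p.2 p.1).prodMk (hasDerivAt_id p.2))

lemma dR2_eq_fderiv (hf : DifferentiableAt ℝ f p) : dR2 f p = fderiv ℝ f p (1, 0) :=
  (hasDerivAt_fst_slice hf).deriv

lemma dTh2_eq_fderiv (hf : DifferentiableAt ℝ f p) : dTh2 f p = fderiv ℝ f p (0, 1) :=
  (hasDerivAt_snd_slice hf).deriv

lemma dR2_add (hf : DifferentiableAt ℝ f p) (hg : DifferentiableAt ℝ g p) :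
    dR2 (fun q => f q + g q) p = dR2 f p + dR2 g p := by
  rw [dR2_eq_fderiv hf, dR2_eq_fderiv hg]
  exact ((hasDerivAt_fst_slice hf).add (hasDerivAt_fst_slice hg)).deriv

lemma dTh2_add (hf : DifferentiableAt ℝ f p) (hg : DifferentiableAt ℝ g p) :
    dTh2 (fun q => f q + g q) p = dTh2 f p + dTh2 g p := by
  rw [dTh2_eq_fderiv hf, dTh2_eq_fderiv hg]
  exact ((hasDerivAt_snd_slice hf).add (hasDerivAt_snd_slice hg)).deriv

lemma ContDiffOn.differentiableAt_of_isOpen {n : WithTop ℕ∞} (hf : ContDiffOn ℝ n f U)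
    (hU : IsOpen U) (hn : n ≠ 0) (hp : p ∈ U) : DifferentiableAt ℝ f p :=
  (hf.contDiffAt (hU.mem_nhds hp)).differentiableAt hn

lemma contDiffOn_dR2 {k n : WithTop ℕ∞} (hU : IsOpen U) (hf : ContDiffOn ℝ n f U)
    (hkn : k + 1 ≤ n) : ContDiffOn ℝ k (dR2 f) U := by
  have hn : n ≠ 0 := by rintro rfl; simp at hkn
  refine ((hf.fderiv_of_isOpen hU hkn).clm_apply
    (contDiffOn_const (c := ((1, 0) : ℝ × ℝ)))).congr fun q hq => ?_
  exact dR2_eq_fderiv (hf.differentiableAt_of_isOpen hU hn hq)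

lemma contDiffOn_dTh2 {k n : WithTop ℕ∞} (hU : IsOpen U) (hf : ContDiffOn ℝ n f U)
    (hkn : k + 1 ≤ n) : ContDiffOn ℝ k (dTh2 f) U := by
  have hn : n ≠ 0 := by rintro rfl; simp at hkn
  refine ((hf.fderiv_of_isOpen hU hkn).clm_apply
    (contDiffOn_const (c := ((0, 1) : ℝ × ℝ)))).congr fun q hq => ?_
  exact dTh2_eq_fderiv (hf.differentiableAt_of_isOpen hU hn hq)

lemma dR2_dTh2_comm (hU : IsOpen U) (hf : ContDiffOn ℝ 2 f U) (hp : p ∈ U) :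
    dR2 (dTh2 f) p = dTh2 (dR2 f) p := by
  have hd : ∀ q ∈ U, DifferentiableAt ℝ f q := fun q hq =>
    hf.differentiableAt_of_isOpen hU (by norm_num) hq
  have hf' : DifferentiableAt ℝ (fderiv ℝ f) p :=
    ((hf.fderiv_of_isOpen (m := 1) hU (by norm_num)).contDiffAt
      (hU.mem_nhds hp)).differentiableAt (by norm_num)
  have key : ∀ w x : ℝ × ℝ,
      fderiv ℝ (fun q => fderiv ℝ f q w) p x = fderiv ℝ (fderiv ℝ f) p x w := by
    intro w x
    rw [fderiv_clm_apply hf' (differentiableAt_const w)]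
    simp
  rw [dR2_congr hU (fun q hq => dTh2_eq_fderiv (hd q hq)) hp,
    dTh2_congr hU (fun q hq => dR2_eq_fderiv (hd q hq)) hp,
    dR2_eq_fderiv (hf'.clm_apply (differentiableAt_const _)),
    dTh2_eq_fderiv (hf'.clm_apply (differentiableAt_const _)), key, key]
  exact ((hf.contDiffAt (hU.mem_nhds hp)).isSymmSndFDerivAt (by simp)) _ _

end PartialDerivatives

/-- The radial operator `u ↦ -Δ∂ᵣ(Δ∂ᵣu) - a²m²u`. -/
noncomputable def radialOp (M a : ℝ) (m : ℤ) (u : F2) : F2 := fun p =>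
  -(Complex.ofReal (Del2 M a p.1) * dR2 (fun q => Complex.ofReal (Del2 M a q.1) * dR2 u q) p)
    + -((a : ℂ) ^ 2 * (m : ℂ) ^ 2) * u p

/-- The angular operator `u ↦ -(1/sinθ)∂_θ(sinθ ∂_θu) + (m²/sin²θ)u`. -/
noncomputable def angularOp (m : ℤ) (u : F2) : F2 := fun p =>
  -((Complex.ofReal (Real.sin p.2))⁻¹ * dTh2 (fun q => Complex.ofReal (Real.sin q.2) * dTh2 u q) p)
    + (m : ℂ) ^ 2 * ((Complex.ofReal (Real.sin p.2))⁻¹) ^ 2 * u p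

lemma ACop_eq {M a : ℝ} (m : ℤ) (u : F2) {p : ℝ × ℝ} (hp : p ∈ OmegaRS M a) :
    ACop M a m u p = (Complex.ofReal (DSb M a p))⁻¹ *
      (radialOp M a m u p + Complex.ofReal (Del2 M a p.1) * angularOp m u p) := by
  have hs : (Complex.ofReal (Real.sin p.2)) ≠ 0 :=
    Complex.ofReal_ne_zero.mpr (sin_pos_of_mem_OmegaRS hp).ne'
  unfold ACop radialOp angularOp
  congr 1
  generalize dTh2 _ p = x
  generalize dR2 _ p = y
  push_cast only [Complex.ofReal_div, Complex.ofReal_sub, Complex.ofReal_mul, Complex.ofReal_pow]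
  field_simp
  ring

lemma Ps_eq {M a : ℝ} (m : ℤ) (u : F2) {p : ℝ × ℝ} (hp : p ∈ OmegaRS M a) :
    Ps M a m u p = Complex.ofReal (a ^ 2 * Real.sin p.2 ^ 2) * radialOp M a m u p
      + Complex.ofReal ((p.1 ^ 2 + a ^ 2) ^ 2) * angularOp m u p := by
  have hs : (Complex.ofReal (Real.sin p.2)) ≠ 0 :=
    Complex.ofReal_ne_zero.mpr (sin_pos_of_mem_OmegaRS hp).ne'
  have hS : Sig2 a p = p.1 ^ 2 + a ^ 2 - a ^ 2 * Real.sin p.2 ^ 2 := by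
    unfold Sig2
    rw [Real.cos_sq']
    ring
  unfold Ps radialOp angularOp
  rw [hS]
  generalize dTh2 _ p = x
  generalize dR2 _ p = y
  simp only [Complex.ofReal_div, Complex.ofReal_sub, Complex.ofReal_add, Complex.ofReal_mul,
    Complex.ofReal_pow, Complex.ofReal_ofNat]
  field_simp
  ring

section SeparatedOperators

variable {M a : ℝ} {m : ℤ} {f g : F2} {p : ℝ × ℝ}

lemma radialOp_congr (h : EqOn f g (OmegaRS M a)) (hp : p ∈ OmegaRS M a) :
    radialOp M a m f p = radialOp M a m g p := by
  have hU := isOpen_OmegaRS M a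
  unfold radialOp
  rw [h hp, dR2_congr hU (fun q hq => by
    change Complex.ofReal (Del2 M a q.1) * dR2 f q = Complex.ofReal (Del2 M a q.1) * dR2 g q
    rw [dR2_congr hU h hq]) hp]

lemma angularOp_congr (h : EqOn f g (OmegaRS M a)) (hp : p ∈ OmegaRS M a) :
    angularOp m f p = angularOp m g p := by
  have hU := isOpen_OmegaRS M a
  unfold angularOp
  rw [h hp, dTh2_congr hU (fun q hq => by
    change Complex.ofReal (Real.sin q.2) * dTh2 f q = Complex.ofReal (Real.sin q.2) * dTh2 g q
    rw [dTh2_congr hU h hq]) hp]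

lemma radialOp_mul_left (c : ℝ → ℂ) (f : F2) (p : ℝ × ℝ) :
    radialOp M a m (fun q => c q.2 * f q) p = c p.2 * radialOp M a m f p := by
  unfold radialOp
  simp only [dR2_mul_left, mul_left_comm _ (c _)]
  ring

lemma angularOp_mul_left (c : ℝ → ℂ) (f : F2) (p : ℝ × ℝ) :
    angularOp m (fun q => c q.1 * f q) p = c p.1 * angularOp m f p := by
  unfold angularOp
  simp only [dTh2_mul_left, mul_left_comm _ (c _)]
  ring

lemma contDiff_ofReal_Del2 {n : WithTop ℕ∞} :
    ContDiff ℝ n (fun q : ℝ × ℝ => Complex.ofReal (Del2 M a q.1)) := by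
  have h : ContDiff ℝ n (fun q : ℝ × ℝ => Del2 M a q.1) := by
    unfold Del2
    fun_prop
  exact Complex.ofRealCLM.contDiff.comp h

lemma contDiff_ofReal_sq_add_sq {n : WithTop ℕ∞} :
    ContDiff ℝ n (fun q : ℝ × ℝ => Complex.ofReal ((q.1 ^ 2 + a ^ 2) ^ 2)) := by
  have h : ContDiff ℝ n (fun q : ℝ × ℝ => (q.1 ^ 2 + a ^ 2) ^ 2) := by fun_prop
  exact Complex.ofRealCLM.contDiff.comp h

lemma contDiff_ofReal_sin {n : WithTop ℕ∞} :
    ContDiff ℝ n (fun q : ℝ × ℝ => Complex.ofReal (Real.sin q.2)) :=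
  Complex.ofRealCLM.contDiff.comp (Real.contDiff_sin.comp contDiff_snd)

lemma contDiffOn_inv_ofReal_sin {n : WithTop ℕ∞} :
    ContDiffOn ℝ n (fun q : ℝ × ℝ => (Complex.ofReal (Real.sin q.2))⁻¹) (OmegaRS M a) :=
  contDiff_ofReal_sin.contDiffOn.inv fun _ hq =>
    Complex.ofReal_ne_zero.mpr (sin_pos_of_mem_OmegaRS hq).ne'

lemma contDiffOn_inv_ofReal_DSb (hM : 0 < M) {n : WithTop ℕ∞} :
    ContDiffOn ℝ n (fun q : ℝ × ℝ => (Complex.ofReal (DSb M a q))⁻¹) (OmegaRS M a) := by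
  refine ContDiffOn.inv (ContDiff.contDiffOn ?_) fun _ hq =>
    Complex.ofReal_ne_zero.mpr (DSb_pos_of_mem_OmegaRS hM hq).ne'
  have h : ContDiff ℝ n (DSb M a) := by
    unfold DSb Sig2
    fun_prop
  exact Complex.ofRealCLM.contDiff.comp h

lemma radialOp_add (hf : ContDiffOn ℝ 2 f (OmegaRS M a)) (hg : ContDiffOn ℝ 2 g (OmegaRS M a))
    (hp : p ∈ OmegaRS M a) :
    radialOp M a m (fun q => f q + g q) p = radialOp M a m f p + radialOp M a m g p := by
  have hU := isOpen_OmegaRS M a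
  have hd : ∀ h : F2, ContDiffOn ℝ 2 h (OmegaRS M a) →
      DifferentiableAt ℝ (fun q => Complex.ofReal (Del2 M a q.1) * dR2 h q) p := fun h hh =>
    (contDiff_ofReal_Del2.contDiffOn.mul (contDiffOn_dR2 (k := 1) hU hh
      (by norm_num))).differentiableAt_of_isOpen hU (by norm_num) hp
  have key : dR2 (fun q => Complex.ofReal (Del2 M a q.1) * dR2 (fun q => f q + g q) q) p
      = dR2 (fun q => Complex.ofReal (Del2 M a q.1) * dR2 f q) p
        + dR2 (fun q => Complex.ofReal (Del2 M a q.1) * dR2 g q) p := by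
    rw [← dR2_add (hd f hf) (hd g hg)]
    refine dR2_congr hU (fun q hq => ?_) hp
    rw [dR2_add (hf.differentiableAt_of_isOpen hU (by norm_num) hq)
      (hg.differentiableAt_of_isOpen hU (by norm_num) hq), mul_add]
  unfold radialOp
  rw [key]
  ring

lemma angularOp_add (hf : ContDiffOn ℝ 2 f (OmegaRS M a)) (hg : ContDiffOn ℝ 2 g (OmegaRS M a))
    (hp : p ∈ OmegaRS M a) :
    angularOp m (fun q => f q + g q) p = angularOp m f p + angularOp m g p := by
  have hU := isOpen_OmegaRS M a
  have hd : ∀ h : F2, ContDiffOn ℝ 2 h (OmegaRS M a) →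
      DifferentiableAt ℝ (fun q => Complex.ofReal (Real.sin q.2) * dTh2 h q) p := fun h hh =>
    (contDiff_ofReal_sin.contDiffOn.mul (contDiffOn_dTh2 (k := 1) hU hh
      (by norm_num))).differentiableAt_of_isOpen hU (by norm_num) hp
  have key : dTh2 (fun q => Complex.ofReal (Real.sin q.2) * dTh2 (fun q => f q + g q) q) p
      = dTh2 (fun q => Complex.ofReal (Real.sin q.2) * dTh2 f q) p
        + dTh2 (fun q => Complex.ofReal (Real.sin q.2) * dTh2 g q) p := by
    rw [← dTh2_add (hd f hf) (hd g hg)]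
    refine dTh2_congr hU (fun q hq => ?_) hp
    rw [dTh2_add (hf.differentiableAt_of_isOpen hU (by norm_num) hq)
      (hg.differentiableAt_of_isOpen hU (by norm_num) hq), mul_add]
  unfold angularOp
  rw [key]
  ring

lemma contDiffOn_radialOp {k l n : WithTop ℕ∞} (hf : ContDiffOn ℝ n f (OmegaRS M a))
    (hkl : k + 1 ≤ l) (hln : l + 1 ≤ n) : ContDiffOn ℝ k (radialOp M a m f) (OmegaRS M a) := by
  have hU := isOpen_OmegaRS M a
  have hkn : k ≤ n := le_self_add.trans (hkl.trans (le_self_add.trans hln))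
  exact ((contDiff_ofReal_Del2.contDiffOn.mul (contDiffOn_dR2 hU
    (contDiff_ofReal_Del2.contDiffOn.mul (contDiffOn_dR2 hU hf hln)) hkl)).neg).add
    (contDiffOn_const.mul (hf.of_le hkn))

lemma contDiffOn_angularOp {k l n : WithTop ℕ∞} (hf : ContDiffOn ℝ n f (OmegaRS M a))
    (hkl : k + 1 ≤ l) (hln : l + 1 ≤ n) : ContDiffOn ℝ k (angularOp m f) (OmegaRS M a) := by
  have hU := isOpen_OmegaRS M a
  have hkn : k ≤ n := le_self_add.trans (hkl.trans (le_self_add.trans hln))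
  exact ((contDiffOn_inv_ofReal_sin.mul (contDiffOn_dTh2 hU
    (contDiff_ofReal_sin.contDiffOn.mul (contDiffOn_dTh2 hU hf hln)) hkl)).neg).add
    ((contDiffOn_const.mul (contDiffOn_inv_ofReal_sin.pow 2)).mul (hf.of_le hkn))

lemma dR2_angularOp (hf : ContDiffOn ℝ 3 f (OmegaRS M a)) (hp : p ∈ OmegaRS M a) :
    dR2 (angularOp m f) p = angularOp m (dR2 f) p := by
  have hU := isOpen_OmegaRS M a
  have h2 : ContDiffOn ℝ 2 (fun q => Complex.ofReal (Real.sin q.2) * dTh2 f q) (OmegaRS M a) :=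
    contDiff_ofReal_sin.contDiffOn.mul (contDiffOn_dTh2 hU hf (by norm_num))
  have h1 := contDiffOn_dTh2 (k := 1) hU h2 (by norm_num)
  have key : dR2 (dTh2 (fun q => Complex.ofReal (Real.sin q.2) * dTh2 f q)) p
      = dTh2 (fun q => Complex.ofReal (Real.sin q.2) * dTh2 (dR2 f) q) p := by
    rw [dR2_dTh2_comm hU h2 hp]
    refine dTh2_congr hU (fun q hq => ?_) hp
    rw [dR2_mul_left (fun t => Complex.ofReal (Real.sin t)),
      dR2_dTh2_comm hU (hf.of_le (by norm_num)) hq]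
  have hsplit : angularOp m f = fun p => -(Complex.ofReal (Real.sin p.2))⁻¹ *
      dTh2 (fun q => Complex.ofReal (Real.sin q.2) * dTh2 f q) p
      + (m : ℂ) ^ 2 * ((Complex.ofReal (Real.sin p.2))⁻¹) ^ 2 * f p := by
    funext q
    unfold angularOp
    ring
  rw [hsplit, dR2_add
    ((contDiffOn_inv_ofReal_sin.neg.mul h1).differentiableAt_of_isOpen hU (by norm_num) hp)
    (((contDiffOn_const.mul (contDiffOn_inv_ofReal_sin.pow 2)).mul
      hf).differentiableAt_of_isOpen hU (by norm_num) hp),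
    dR2_mul_left (fun t => -(Complex.ofReal (Real.sin t))⁻¹),
    dR2_mul_left (fun t => (m : ℂ) ^ 2 * ((Complex.ofReal (Real.sin t))⁻¹) ^ 2), key]
  unfold angularOp
  ring

lemma radialOp_angularOp_comm (hf : ContDiffOn ℝ 4 f (OmegaRS M a)) (hp : p ∈ OmegaRS M a) :
    radialOp M a m (angularOp m f) p = angularOp m (radialOp M a m f) p := by
  have hU := isOpen_OmegaRS M a
  have h3 : ContDiffOn ℝ 3 (fun q => Complex.ofReal (Del2 M a q.1) * dR2 f q) (OmegaRS M a) :=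
    contDiff_ofReal_Del2.contDiffOn.mul (contDiffOn_dR2 hU hf (by norm_num))
  have h2 := contDiffOn_dR2 (k := 2) hU h3 (by norm_num)
  have key : dR2 (fun q => Complex.ofReal (Del2 M a q.1) * dR2 (angularOp m f) q) p
      = angularOp m (dR2 (fun q => Complex.ofReal (Del2 M a q.1) * dR2 f q)) p := by
    rw [← dR2_angularOp h3 hp]
    refine dR2_congr hU (fun q hq => ?_) hp
    rw [angularOp_mul_left (fun r => Complex.ofReal (Del2 M a r))]
    rw [dR2_angularOp (hf.of_le (by norm_num)) hq]
  have hsplit : radialOp M a m f = fun p => -Complex.ofReal (Del2 M a p.1) *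
      dR2 (fun q => Complex.ofReal (Del2 M a q.1) * dR2 f q) p
      + -((a : ℂ) ^ 2 * (m : ℂ) ^ 2) * f p := by
    funext q
    unfold radialOp
    ring
  rw [hsplit, angularOp_add (contDiff_ofReal_Del2.contDiffOn.neg.mul h2)
    (contDiffOn_const.mul (hf.of_le (by norm_num))) hp,
    angularOp_mul_left (fun r => -Complex.ofReal (Del2 M a r)),
    angularOp_mul_left (fun _ => -((a : ℂ) ^ 2 * (m : ℂ) ^ 2)), ← key]
  unfold radialOp
  ring

end SeparatedOperators

/-- The operator `(1/(ΔΣ̄)) P_s`. -/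
noncomputable def symOp (M a : ℝ) (m : ℤ) (u : F2) : F2 := fun p =>
  (Complex.ofReal (DSb M a p))⁻¹ * Ps M a m u p

section Commutators

variable {M a : ℝ} {m : ℤ} {f g : F2} {p : ℝ × ℝ}

lemma ACop_congr (h : EqOn f g (OmegaRS M a)) (hp : p ∈ OmegaRS M a) :
    ACop M a m f p = ACop M a m g p := by
  rw [ACop_eq m f hp, ACop_eq m g hp, radialOp_congr h hp, angularOp_congr h hp]

lemma symOp_congr (h : EqOn f g (OmegaRS M a)) (hp : p ∈ OmegaRS M a) :
    symOp M a m f p = symOp M a m g p := by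
  unfold symOp
  rw [Ps_eq m f hp, Ps_eq m g hp, radialOp_congr h hp, angularOp_congr h hp]

lemma ACop_add (hf : ContDiffOn ℝ 2 f (OmegaRS M a)) (hg : ContDiffOn ℝ 2 g (OmegaRS M a))
    (hp : p ∈ OmegaRS M a) :
    ACop M a m (fun q => f q + g q) p = ACop M a m f p + ACop M a m g p := by
  rw [ACop_eq m _ hp, ACop_eq m f hp, ACop_eq m g hp, radialOp_add hf hg hp,
    angularOp_add hf hg hp]
  ring

lemma symOp_add (hf : ContDiffOn ℝ 2 f (OmegaRS M a)) (hg : ContDiffOn ℝ 2 g (OmegaRS M a))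
    (hp : p ∈ OmegaRS M a) :
    symOp M a m (fun q => f q + g q) p = symOp M a m f p + symOp M a m g p := by
  unfold symOp
  rw [Ps_eq m _ hp, Ps_eq m f hp, Ps_eq m g hp, radialOp_add hf hg hp, angularOp_add hf hg hp]
  ring

lemma ACop_const_mul (c : ℂ) (f : F2) (hp : p ∈ OmegaRS M a) :
    ACop M a m (fun q => c * f q) p = c * ACop M a m f p := by
  rw [ACop_eq m _ hp, ACop_eq m f hp, radialOp_mul_left (fun _ => c),
    angularOp_mul_left (fun _ => c)]
  ring

lemma symOp_const_mul (c : ℂ) (f : F2) (hp : p ∈ OmegaRS M a) :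
    symOp M a m (fun q => c * f q) p = c * symOp M a m f p := by
  unfold symOp
  rw [Ps_eq m _ hp, Ps_eq m f hp, radialOp_mul_left (fun _ => c), angularOp_mul_left (fun _ => c)]
  ring

lemma contDiffOn_ACop (hM : 0 < M) (hf : ContDiffOn ℝ 4 f (OmegaRS M a)) :
    ContDiffOn ℝ 2 (ACop M a m f) (OmegaRS M a) := by
  refine ContDiffOn.congr ?_ fun q hq => ACop_eq m f hq
  exact (contDiffOn_inv_ofReal_DSb hM).mul
    ((contDiffOn_radialOp (l := 3) hf (by norm_num) (by norm_num)).add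
      (contDiff_ofReal_Del2.contDiffOn.mul
        (contDiffOn_angularOp (l := 3) hf (by norm_num) (by norm_num))))

/-- `(1/(ΔΣ̄)) P_s = a² sin²θ (A+C) + Y` with `Y` the angular operator. -/
lemma symOp_eq (hM : 0 < M) (f : F2) (hp : p ∈ OmegaRS M a) :
    symOp M a m f p =
      (a : ℂ) ^ 2 * Complex.ofReal (Real.sin p.2) ^ 2 * ACop M a m f p + angularOp m f p := by
  have hD : (Complex.ofReal (DSb M a p)) ≠ 0 :=
    Complex.ofReal_ne_zero.mpr (DSb_pos_of_mem_OmegaRS hM hp).ne'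
  have hD' := congrArg Complex.ofReal (DSb_eq M a p)
  unfold symOp
  rw [Ps_eq m f hp, ACop_eq m f hp]
  field_simp
  rw [hD']
  push_cast
  ring

/-- `(r²+a²)² (A+C) - Δ (1/(ΔΣ̄)) P_s` is the radial operator. -/
lemma radialOp_eq (hM : 0 < M) (f : F2) (hp : p ∈ OmegaRS M a) :
    radialOp M a m f p = Complex.ofReal ((p.1 ^ 2 + a ^ 2) ^ 2) * ACop M a m f p
      + -Complex.ofReal (Del2 M a p.1) * symOp M a m f p := by
  have hD : (Complex.ofReal (DSb M a p)) ≠ 0 :=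
    Complex.ofReal_ne_zero.mpr (DSb_pos_of_mem_OmegaRS hM hp).ne'
  have hD' := congrArg Complex.ofReal (DSb_eq M a p)
  unfold symOp
  rw [Ps_eq m f hp, ACop_eq m f hp]
  field_simp
  rw [hD']
  push_cast
  ring

lemma contDiffOn_symOp (hM : 0 < M) (hf : ContDiffOn ℝ 4 f (OmegaRS M a)) :
    ContDiffOn ℝ 2 (symOp M a m f) (OmegaRS M a) := by
  refine ContDiffOn.congr ?_ fun q hq => symOp_eq hM f hq
  exact ((contDiffOn_const.mul (contDiff_ofReal_sin.contDiffOn.pow 2)).mul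
    (contDiffOn_ACop hM hf)).add (contDiffOn_angularOp (l := 3) hf (by norm_num) (by norm_num))

/-- `[(1/(ΔΣ̄)) P_s, A+C] = 0`. -/
lemma symOp_ACop_comm (hM : 0 < M) (hf : ContDiffOn ℝ 4 f (OmegaRS M a))
    (hp : p ∈ OmegaRS M a) :
    symOp M a m (ACop M a m f) p = ACop M a m (symOp M a m f) p := by
  have hA := contDiffOn_ACop (m := m) hM hf
  have hS := contDiffOn_symOp (m := m) hM hf
  have hY : EqOn (angularOp m f) (fun q => symOp M a m f q +
      -((a : ℂ) ^ 2 * Complex.ofReal (Real.sin q.2) ^ 2) * ACop M a m f q) (OmegaRS M a) := by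
    intro q hq
    simp only [symOp_eq hM f hq]
    ring
  have hX : EqOn (radialOp M a m f) (fun q =>
      Complex.ofReal ((q.1 ^ 2 + a ^ 2) ^ 2) * ACop M a m f q
      + -Complex.ofReal (Del2 M a q.1) * symOp M a m f q) (OmegaRS M a) :=
    fun q hq => radialOp_eq hM f hq
  have hcomm := radialOp_angularOp_comm (m := m) hf hp
  have hρ : ContDiff ℝ 2 (fun q : ℝ × ℝ => Complex.ofReal ((q.1 ^ 2 + a ^ 2) ^ 2)) :=
    contDiff_ofReal_sq_add_sq
  rw [radialOp_congr hY hp, angularOp_congr hX hp,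
    radialOp_add hS (((contDiffOn_const.mul
      (contDiff_ofReal_sin.contDiffOn.pow 2)).neg).mul hA) hp,
    angularOp_add (hρ.contDiffOn.mul hA) (contDiff_ofReal_Del2.contDiffOn.neg.mul hS) hp,
    radialOp_mul_left (fun t => -((a : ℂ) ^ 2 * Complex.ofReal (Real.sin t) ^ 2)),
    angularOp_mul_left (fun r => Complex.ofReal ((r ^ 2 + a ^ 2) ^ 2)),
    angularOp_mul_left (fun r => -Complex.ofReal (Del2 M a r))] at hcomm
  rw [ACop_eq m _ hp]
  conv_lhs => unfold symOp
  rw [Ps_eq m _ hp]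
  push_cast at hcomm ⊢
  linear_combination -(Complex.ofReal (DSb M a p))⁻¹ * hcomm

/-- `[(1/(ΔΣ̄)) P_s, w] = [A+C, a² sin²θ w]` for the weight `w = r/(ΔΣ̄)`. -/
lemma symOp_weight_comm (hM : 0 < M) (hf : ContDiffOn ℝ 2 f (OmegaRS M a))
    (hp : p ∈ OmegaRS M a) :
    symOp M a m (fun q => (q.1 : ℂ) * (Complex.ofReal (DSb M a q))⁻¹ * f q) p
        - (p.1 : ℂ) * (Complex.ofReal (DSb M a p))⁻¹ * symOp M a m f p
      = ACop M a m (fun q => (a : ℂ) ^ 2 * Complex.ofReal (Real.sin q.2) ^ 2 *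
            ((q.1 : ℂ) * (Complex.ofReal (DSb M a q))⁻¹ * f q)) p
        - (a : ℂ) ^ 2 * Complex.ofReal (Real.sin p.2) ^ 2 *
            ((p.1 : ℂ) * (Complex.ofReal (DSb M a p))⁻¹) * ACop M a m f p := by
  have hw : ContDiffOn ℝ 2 (fun q : ℝ × ℝ => (q.1 : ℂ) * (Complex.ofReal (DSb M a q))⁻¹ * f q)
      (OmegaRS M a) :=
    ((Complex.ofRealCLM.contDiff.comp contDiff_fst).contDiffOn.mul
      (contDiffOn_inv_ofReal_DSb hM)).mul hf
  set w : F2 := fun q => (q.1 : ℂ) * (Complex.ofReal (DSb M a q))⁻¹ * f q with hw_def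
  have hρ : ContDiff ℝ 2 (fun q : ℝ × ℝ => Complex.ofReal ((q.1 ^ 2 + a ^ 2) ^ 2)) :=
    contDiff_ofReal_sq_add_sq
  have hαw : ContDiffOn ℝ 2 (fun q : ℝ × ℝ =>
      (a : ℂ) ^ 2 * Complex.ofReal (Real.sin q.2) ^ 2 * w q) (OmegaRS M a) :=
    (contDiffOn_const.mul (contDiff_ofReal_sin.contDiffOn.pow 2)).mul hw
  have hY : EqOn (fun q => (q.1 : ℂ) * f q) (fun q =>
      Complex.ofReal ((q.1 ^ 2 + a ^ 2) ^ 2) * w q + -Complex.ofReal (Del2 M a q.1) *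
        ((a : ℂ) ^ 2 * Complex.ofReal (Real.sin q.2) ^ 2 * w q)) (OmegaRS M a) := by
    intro q hq
    have hD : (Complex.ofReal (DSb M a q)) ≠ 0 :=
      Complex.ofReal_ne_zero.mpr (DSb_pos_of_mem_OmegaRS hM hq).ne'
    have hD' := congrArg Complex.ofReal (DSb_eq M a q)
    simp only [hw_def]
    field_simp
    rw [hD']
    push_cast
    ring
  have key := angularOp_congr (m := m) hY hp
  rw [angularOp_mul_left (fun r => (r : ℂ)),
    angularOp_add (hρ.contDiffOn.mul hw) (contDiff_ofReal_Del2.contDiffOn.neg.mul hαw) hp,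
    angularOp_mul_left (fun r => Complex.ofReal ((r ^ 2 + a ^ 2) ^ 2)),
    angularOp_mul_left (fun r => -Complex.ofReal (Del2 M a r))] at key
  rw [symOp_eq hM f hp, ACop_eq m (fun q => _ * w q) hp,
    radialOp_mul_left (fun t => (a : ℂ) ^ 2 * Complex.ofReal (Real.sin t) ^ 2)]
  unfold symOp
  rw [Ps_eq m w hp]
  push_cast at key ⊢
  linear_combination -(Complex.ofReal (DSb M a p))⁻¹ * key

end Commutators

/-- for `(u,v) ∈ C⁴₀(Ω_rs, ℂ) × C²₀(Ω_rs, ℂ)`, the operator `Ŝ` commutes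
with the generator `G` of time evolution: `Ŝ G(u,v) = G Ŝ(u,v)`. -/
theorem Shat_commutes_Gop (M a : ℝ) (m : ℤ) (hM : 0 < M) (ha : 0 ≤ a) (haM : a ≤ M)
    (u v : F2)
    (hu : ContDiff ℝ 4 u) (hus : HasCompactSupport u) (husup : tsupport u ⊆ OmegaRS M a)
    (hv : ContDiff ℝ 2 v) (hvs : HasCompactSupport v) (hvsup : tsupport v ⊆ OmegaRS M a) :
    ∀ p ∈ OmegaRS M a,
      (Shat M a m (Gop M a m (u, v))).1 p = (Gop M a m (Shat M a m (u, v))).1 p ∧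
      (Shat M a m (Gop M a m (u, v))).2 p = (Gop M a m (Shat M a m (u, v))).2 p := by
  intro p hp
  have hu4 : ContDiffOn ℝ 4 u (OmegaRS M a) := hu.contDiffOn
  have hv2 : ContDiffOn ℝ 2 v (OmegaRS M a) := hv.contDiffOn
  have hD : ∀ q ∈ OmegaRS M a, (Complex.ofReal (DSb M a q)) ≠ 0 := fun q hq =>
    Complex.ofReal_ne_zero.mpr (DSb_pos_of_mem_OmegaRS hM hq).ne'
  have hf : ∀ q ∈ OmegaRS M a,
      (Complex.ofReal (DSb M a q))⁻¹ * Complex.ofReal ((q.1 ^ 2 + a ^ 2) * Sig2 a q)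
        = 1 - 2 * M * (a ^ 2 * Complex.ofReal (Real.sin q.2) ^ 2 *
          (q.1 * (Complex.ofReal (DSb M a q))⁻¹)) := by
    intro q hq
    have h := hD q hq
    have hD' := congrArg Complex.ofReal (show (q.1 ^ 2 + a ^ 2) * Sig2 a q
      = DSb M a q - 2 * M * a ^ 2 * q.1 * Real.sin q.2 ^ 2 by unfold DSb; ring)
    rw [hD']
    field_simp
    push_cast
    ring
  have hPs : ∀ w : F2, (Complex.ofReal (DSb M a p))⁻¹ * Ps M a m w p = symOp M a m w p :=
    fun _ => rfl
  have hneg : ∀ w : F2, (fun q => -w q) = fun q => (-1 : ℂ) * w q := fun w => by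
    funext q; ring
  set w : F2 := fun q => (q.1 : ℂ) * (Complex.ofReal (DSb M a q))⁻¹ * v q with hw_def
  have hw : ContDiffOn ℝ 2 w (OmegaRS M a) :=
    ((Complex.ofRealCLM.contDiff.comp contDiff_fst).contDiffOn.mul
      (contDiffOn_inv_ofReal_DSb hM)).mul hv2
  have hαw : ContDiffOn ℝ 2 (fun q : ℝ × ℝ =>
      (a : ℂ) ^ 2 * Complex.ofReal (Real.sin q.2) ^ 2 * w q) (OmegaRS M a) :=
    (contDiffOn_const.mul (contDiff_ofReal_sin.contDiffOn.pow 2)).mul hw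
  have hSv : symOp M a m (fun q => -v q) p = -symOp M a m v p := by
    rw [hneg, symOp_const_mul _ _ hp]; ring
  have hAv : ACop M a m (fun q => -v q) p = -ACop M a m v p := by
    rw [hneg, ACop_const_mul _ _ hp]; ring
  have hS2 : symOp M a m (fun q => ACop M a m u q + Complex.I * Bop M a m v q) p
      = ACop M a m (symOp M a m u) p + Complex.I * (4 * m * M * a) * symOp M a m w p := by
    rw [symOp_congr (g := fun q => ACop M a m u q + Complex.I * (4 * m * M * a) * w q) ?_ hp,
      symOp_add (contDiffOn_ACop hM hu4) (contDiffOn_const.mul hw) hp,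
      symOp_const_mul _ _ hp, symOp_ACop_comm hM hu4 hp]
    intro q hq
    simp only [hw_def, Bop]
    push_cast
    ring
  have hA2 : ACop M a m (Shat M a m (u, v)).1 p
      = ACop M a m (symOp M a m u) p + (-(2 * Complex.I * m * a) * ACop M a m v p
        + 2 * Complex.I * m * a * (2 * M) * ACop M a m (fun q : ℝ × ℝ =>
      (a : ℂ) ^ 2 * Complex.ofReal (Real.sin q.2) ^ 2 * w q) p) := by
    rw [ACop_congr (g := fun q => symOp M a m u q + (-(2 * Complex.I * m * a) * v q
        + 2 * Complex.I * m * a * (2 * M) * ((a : ℂ) ^ 2 * Complex.ofReal (Real.sin q.2) ^ 2 * w q)))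
        ?_ hp,
      ACop_add (contDiffOn_symOp hM hu4)
        ((contDiffOn_const.mul hv2).add (contDiffOn_const.mul hαw)) hp,
      ACop_add (contDiffOn_const.mul hv2) (contDiffOn_const.mul hαw) hp,
      ACop_const_mul _ _ hp, ACop_const_mul _ _ hp]
    intro q hq
    simp only [hw_def, Shat, symOp]
    linear_combination (-(2 * Complex.I * m * a) * v q) * hf q hq
  have hcomm : symOp M a m w p - (p.1 : ℂ) * (Complex.ofReal (DSb M a p))⁻¹ * symOp M a m v p
      = ACop M a m (fun q => (a : ℂ) ^ 2 * Complex.ofReal (Real.sin q.2) ^ 2 * w q) p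
        - (a : ℂ) ^ 2 * Complex.ofReal (Real.sin p.2) ^ 2 *
            ((p.1 : ℂ) * (Complex.ofReal (DSb M a p))⁻¹) * ACop M a m v p :=
    symOp_weight_comm hM hv2 hp
  have hfp := hf p hp
  have hSv' := (hPs _).trans hSv
  have hS2' := (hPs _).trans hS2
  constructor
  · simp only [Shat, Gop]
    linear_combination hSv' + hPs v - (2 * (m : ℂ) * a * (Complex.ofReal (DSb M a p))⁻¹ *
      Complex.ofReal ((p.1 ^ 2 + a ^ 2) * Sig2 a p) * Bop M a m v p) * Complex.I_sq
  · change _ = ACop M a m (Shat M a m (u, v)).1 p + Complex.I * Bop M a m (Shat M a m (u, v)).2 p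
    rw [hA2]
    simp only [Gop, Shat]
    rw [hAv]
    have hB : ∀ x : F2, Bop M a m x p =
        4 * m * M * a * p.1 * (Complex.ofReal (DSb M a p))⁻¹ * x p := by
      intro x
      simp only [Bop]
      push_cast
      ring
    simp only [hB]
    linear_combination hS2' + 4 * Complex.I * m * M * a * hcomm
      - 4 * Complex.I * m * M * a * p.1 * (Complex.ofReal (DSb M a p))⁻¹ * hPs v
      - 2 * Complex.I * m * a * ACop M a m v p * hfp
      - 2 * m * a * (Complex.ofReal (DSb M a p))⁻¹
        * Complex.ofReal ((p.1 ^ 2 + a ^ 2) * Sig2 a p)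
        * (4 * m * M * a * p.1 * (Complex.ofReal (DSb M a p))⁻¹) * ACop M a m u p * Complex.I_sq
end
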